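/- For all integers q, b, v, d ≥ 1 with v ≥ 2d and 2q > 2b ≥ q, there exists a finite simple graph G on n vertices with minimum degree at least (1 - (v-d)/(b·v))·n such that, if d/v < (b-1)·(q-b)/(binom(q,2) - (q-b)), then G admits no fractional K_q-decomposition. -/

import Mathlib

open scoped Classical

/-- A fractional `K_q`-decomposition of `G`: an assignment of non-negative real weights to the
copies of `K_q` (i.e. the `q`-cliques) of `G` such that for every edge of `G`, the total weight
of the `q`-cliques containing that edge is exactly `1`. -/
def SimpleGraph.HasFractionalDecomposition {V : Type*} [Fintype V] (G : SimpleGraph V)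
    (q : ℕ) : Prop :=
  ∃ w : Finset V → ℝ, (∀ s, 0 ≤ w s) ∧
    ∀ ⦃u v : V⦄, G.Adj u v →
      ∑ s ∈ Finset.univ.filter (fun s : Finset V => G.IsNClique q s ∧ u ∈ s ∧ v ∈ s), w s = 1

open Finset in
/-- Splitting a `q`-set into `b` classes leaves at least `3q - 2b` ordered pairs (diagonal pairs
included) inside the classes. -/
theorem three_mul_card_sub_le_sum_same_class {V : Type*} {b : ℕ} (c : V → Fin b) (s : Finset V) :
    3 * (#s : ℝ) - 2 * b ≤ ∑ x ∈ s, ∑ y ∈ s, if c y = c x then (1 : ℝ) else 0 := by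
  have hcount : ∑ x ∈ s, ∑ y ∈ s, (if c y = c x then (1 : ℝ) else 0)
      = ∑ i : Fin b, (#{x ∈ s | c x = i} : ℝ) ^ 2 := by
    calc ∑ x ∈ s, ∑ y ∈ s, (if c y = c x then (1 : ℝ) else 0)
        = ∑ x ∈ s, ∑ y ∈ s, ∑ i : Fin b,
            (if c x = i then (1 : ℝ) else 0) * (if c y = i then (1 : ℝ) else 0) := by
          refine sum_congr rfl fun x _ => sum_congr rfl fun y _ => ?_
          simp [eq_comm]
      _ = ∑ i : Fin b, ∑ x ∈ s, ∑ y ∈ s,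
            (if c x = i then (1 : ℝ) else 0) * (if c y = i then (1 : ℝ) else 0) := by
          rw [sum_comm (s := univ)]
          exact sum_congr rfl fun x _ => sum_comm
      _ = _ := by
          refine sum_congr rfl fun i _ => ?_
          rw [← sum_mul_sum, sum_boole, sq]
  have hcard : (#s : ℝ) = ∑ i : Fin b, (#{x ∈ s | c x = i} : ℝ) := by
    exact_mod_cast card_eq_sum_card_fiberwise (f := c) (s := s) (t := univ) (by simp)
  have hb : (b : ℝ) = ∑ _i : Fin b, (1 : ℝ) := by simp
  rw [hcount, hcard, hb, mul_sum, mul_sum, ← sum_sub_distrib]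
  refine sum_le_sum fun i _ => ?_
  have hint : ∀ k : ℕ, 3 * (k : ℝ) - 2 * 1 ≤ (k : ℝ) ^ 2 := by
    intro k
    rcases Nat.lt_or_ge k 2 with hk | hk
    · interval_cases k <;> norm_num
    · have : (2 : ℝ) ≤ k := by exact_mod_cast hk
      nlinarith
  exact hint _

open Finset in
/-- If the vertices of a graph are split into `b` classes such that each vertex has `a` neighbours
inside its class and `m` outside, then a fractional `K_q`-decomposition forces `a` to be large
compared with `m`, as each `K_q` has at least `q - b` edges inside the classes. -/
theorem SimpleGraph.HasFractionalDecomposition.mul_le_mul {V : Type*} [Fintype V] [Nonempty V]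
    {G : SimpleGraph V} {q b : ℕ} (h : G.HasFractionalDecomposition q) (c : V → Fin b) {a m : ℕ}
    (ha : ∀ x, #{y | G.Adj x y ∧ c y = c x} = a) (hm : ∀ x, #{y | G.Adj x y ∧ c y ≠ c x} = m) :
    ((q : ℝ) - b) * m ≤ ((q.choose 2 : ℝ) - ((q : ℝ) - b)) * a := by
  obtain ⟨w, hw, hsum⟩ := h
  set D : ℝ := (q.choose 2 : ℝ) with hD
  set e : ℝ := (q : ℝ) - b with he
  have hD2 : D = q * (q - 1) / 2 := Nat.cast_choose_two ℝ q
  let P : V → V → ℝ := fun x y => if G.Adj x y then (if c y = c x then D - e else -e) else 0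
  have htotal : ∑ x, ∑ y, P x y = Fintype.card V * ((D - e) * a - e * m) := by
    have hx : ∀ x, ∑ y, P x y = (D - e) * a - e * m := by
      intro x
      have hP : ∀ y, P x y = (D - e) * (if G.Adj x y ∧ c y = c x then 1 else 0)
          - e * (if G.Adj x y ∧ c y ≠ c x then 1 else 0) := by
        intro y
        by_cases h1 : G.Adj x y <;> by_cases h2 : c y = c x <;> simp [P, h1, h2]
      simp_rw [hP]
      rw [sum_sub_distrib, ← mul_sum, ← mul_sum, sum_boole, sum_boole, ha, hm]
    rw [sum_congr rfl fun x _ => hx x, sum_const, card_univ, nsmul_eq_mul]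
  have hclique : ∀ s : Finset V, G.IsNClique q s → 0 ≤ ∑ x ∈ s, ∑ y ∈ s, P x y := by
    intro s hs
    have hP : ∀ x ∈ s, ∀ y ∈ s, P x y
        = D * (if c y = c x then 1 else 0) - e - (if x = y then D - e else 0) := by
      intro x hx y hy
      by_cases hxy : x = y
      · subst hxy; simp [P]
      · have hadj : G.Adj x y := hs.isClique hx hy hxy
        by_cases h2 : c y = c x <;> simp [P, hadj, h2, hxy]
    have heval : ∑ x ∈ s, ∑ y ∈ s, P x y
        = D * (∑ x ∈ s, ∑ y ∈ s, if c y = c x then (1 : ℝ) else 0)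
          - q * (q * e) - q * (D - e) := by
      rw [sum_congr rfl fun x hx => sum_congr rfl fun y hy => hP x hx y hy]
      simp only [sum_sub_distrib, ← mul_sum, sum_const, hs.card_eq, nsmul_eq_mul, sum_ite_eq]
      rw [sum_congr rfl fun x hx => if_pos hx, sum_const, hs.card_eq, nsmul_eq_mul]
    have hpairs := three_mul_card_sub_le_sum_same_class c s
    rw [hs.card_eq] at hpairs
    have hmul := mul_le_mul_of_nonneg_left hpairs (show 0 ≤ D from Nat.cast_nonneg _)
    rw [heval]
    have : D * (3 * q - 2 * b) - q * (q * e) - q * (D - e) = 0 := by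
      rw [hD2, he]; ring
    linarith
  have hswap : ∑ x, ∑ y, P x y
      = ∑ s : Finset V, if G.IsNClique q s then w s * ∑ x ∈ s, ∑ y ∈ s, P x y else 0 := by
    have hexp : ∀ x y, P x y
        = ∑ s : Finset V, if G.IsNClique q s ∧ x ∈ s ∧ y ∈ s then w s * P x y else 0 := by
      intro x y
      rw [← sum_filter, ← sum_mul]
      by_cases hadj : G.Adj x y
      · rw [hsum hadj, one_mul]
      · simp [P, hadj]
    calc ∑ x, ∑ y, P x y
        = ∑ x, ∑ s : Finset V, ∑ y,
            if G.IsNClique q s ∧ x ∈ s ∧ y ∈ s then w s * P x y else 0 := by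
          refine sum_congr rfl fun x _ => ?_
          rw [sum_comm]
          exact sum_congr rfl fun y _ => hexp x y
      _ = _ := by
          rw [sum_comm]
          refine sum_congr rfl fun s _ => ?_
          by_cases hs : G.IsNClique q s
          · simp only [hs, true_and, if_true, mul_sum]
            simp only [ite_and, sum_ite_irrel, sum_const_zero, sum_ite_mem, univ_inter]
          · simp [hs]
  have hnonneg : 0 ≤ ∑ x, ∑ y, P x y := by
    rw [hswap]
    refine sum_nonneg fun s _ => ?_
    split_ifs with hs
    · exact mul_nonneg (hw s) (hclique s hs)
    · exact le_rfl
  rw [htotal] at hnonneg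
  have hpos : (0 : ℝ) < Fintype.card V := by exact_mod_cast Fintype.card_pos
  linarith [nonneg_of_mul_nonneg_right hnonneg hpos]

/-- The join of `b` copies of a bipartite graph on `2v` vertices, in which `x` and `y` on
opposite sides are adjacent when the residue of `x + y` modulo `v` is less than `k`. -/
def joinBipartite (b v k : ℕ) : SimpleGraph (Fin b × Bool × ZMod v) where
  Adj x y := x.1 ≠ y.1 ∨ (x.2.1 ≠ y.2.1 ∧ (x.2.2 + y.2.2).val < k)
  symm := ⟨fun x y h => by rwa [ne_comm, ne_comm (a := y.2.1), add_comm y.2.2]⟩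
  loopless := ⟨fun x h => by simp at h⟩

open Finset in
theorem card_zmod_add_val_lt {v k : ℕ} [NeZero v] (hk : k ≤ v) (x : ZMod v) :
    #{y : ZMod v | (x + y).val < k} = k := by
  have h1 : #{y : ZMod v | (x + y).val < k} = #{y : ZMod v | y.val < k} := by
    refine card_bij (fun y _ => x + y) (by simp) (by simp) fun y hy => ⟨y - x, ?_, by simp⟩
    simpa using hy
  rw [h1]
  conv_rhs => rw [← card_range k]
  refine card_bij (fun y _ => y.val) (by simp) (fun _ _ _ _ h => ZMod.val_injective v h) ?_
  intro i hi
  have hi' : i < k := by simpa using hi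
  have hval : (i : ZMod v).val = i := ZMod.val_cast_of_lt (by omega)
  exact ⟨i, by simpa [hval] using hi', hval⟩

open Finset in
theorem joinBipartite_card_same {b v k : ℕ} [NeZero v] (hk : k ≤ v)
    (x : Fin b × Bool × ZMod v) :
    #{y | (joinBipartite b v k).Adj x y ∧ y.1 = x.1} = k := by
  have : univ.filter (fun y => (joinBipartite b v k).Adj x y ∧ y.1 = x.1)
      = ({x.1} : Finset (Fin b)) ×ˢ (({!x.2.1} : Finset Bool) ×ˢ
          (univ.filter fun y : ZMod v => (x.2.2 + y).val < k)) := by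
    ext ⟨i, s, y⟩
    obtain ⟨j, t, z⟩ := x
    by_cases hij : i = j
    · subst hij
      cases s <;> cases t <;> simp [joinBipartite]
    · simp [hij, Ne.symm hij]
  rw [this, card_product, card_product, card_zmod_add_val_lt hk]
  simp

open Finset in
theorem joinBipartite_card_ne {b v k : ℕ} [NeZero v] (x : Fin b × Bool × ZMod v) :
    #{y | (joinBipartite b v k).Adj x y ∧ y.1 ≠ x.1} = (b - 1) * (2 * v) := by
  have : univ.filter (fun y => (joinBipartite b v k).Adj x y ∧ y.1 ≠ x.1)
      = (univ.erase x.1) ×ˢ (univ : Finset (Bool × ZMod v)) := by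
    ext y
    simp only [mem_filter, mem_univ, true_and, mem_product, mem_erase, and_true]
    exact ⟨fun h => h.2, fun h => ⟨Or.inl h.symm, h⟩⟩
  rw [this, card_product, card_erase_of_mem (mem_univ _)]
  simp [ZMod.card]

/-- For all integers `q, b, v, d ≥ 1` with `v ≥ 2d` and `2q > 2b ≥ q`, there exists a graph
`G` on `n` vertices with minimum degree at least `(1 - (v-d)/(b·v))·n` such that, if
`d/v < (b-1)·(q-b)/(binom(q,2) - (q-b))`, then `G` admits no fractional
`K_q`-decomposition. -/
theorem statement8 (q b v d : ℕ) (hq : 1 ≤ q) (hb : 1 ≤ b) (hv : 1 ≤ v) (hd : 1 ≤ d)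
    (hvd : 2 * d ≤ v) (hbq : q ≤ 2 * b) (hbq' : 2 * b < 2 * q) :
    ∃ (n : ℕ) (G : SimpleGraph (Fin n)),
      (1 - ((v : ℝ) - d) / (b * v)) * n ≤ (G.minDegree : ℝ) ∧
      ((d : ℝ) / v < ((b : ℝ) - 1) * ((q : ℝ) - b) / ((q.choose 2 : ℝ) - ((q : ℝ) - b)) →
        ¬ G.HasFractionalDecomposition q) := by
  have : NeZero v := ⟨by omega⟩
  have hcardV : Fintype.card (Fin b × Bool × ZMod v) = 2 * b * v := by
    simp [ZMod.card]; ring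
  let f : Fin (2 * b * v) ≃ Fin b × Bool × ZMod v := (Fintype.equivFinOfCardEq hcardV).symm
  obtain ⟨G, hG⟩ : ∃ G : SimpleGraph (Fin (2 * b * v)),
      ∀ x y, G.Adj x y ↔ (joinBipartite b v (2 * d)).Adj (f x) (f y) :=
    ⟨(joinBipartite b v (2 * d)).comap f, fun _ _ => Iff.rfl⟩
  have hn : 0 < 2 * b * v := by positivity
  have : Nonempty (Fin (2 * b * v)) := ⟨⟨0, hn⟩⟩
  have ha : ∀ x, Finset.card {y | G.Adj x y ∧ (f y).1 = (f x).1} = 2 * d := by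
    intro x
    exact (Finset.card_equiv f (by simp [hG])).trans (joinBipartite_card_same hvd (f x))
  have hm : ∀ x, Finset.card {y | G.Adj x y ∧ (f y).1 ≠ (f x).1} = (b - 1) * (2 * v) := by
    intro x
    exact (Finset.card_equiv f (by simp [hG])).trans (joinBipartite_card_ne (k := 2 * d) (f x))
  have hb0 : (0 : ℝ) < b := by exact_mod_cast hb
  have hv0 : (0 : ℝ) < v := by exact_mod_cast hv
  have hd0 : (0 : ℝ) < d := by exact_mod_cast hd
  refine ⟨2 * b * v, G, ?_, fun hlt hdec => ?_⟩
  · have hdeg : ∀ x, G.degree x = 2 * d + (b - 1) * (2 * v) := by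
      intro x
      rw [← ha x, ← hm x, ← Finset.filter_filter, ← Finset.filter_filter,
        Finset.card_filter_add_card_filter_not, ← SimpleGraph.card_neighborFinset_eq_degree,
        SimpleGraph.neighborFinset_eq_filter]
    have hmin : 2 * d + (b - 1) * (2 * v) ≤ G.minDegree :=
      G.le_minDegree_of_forall_le_degree _ fun x => (hdeg x).ge
    have hmin' : (2 : ℝ) * d + (b - 1) * (2 * v) ≤ G.minDegree := by
      have h := (Nat.cast_le (α := ℝ)).2 hmin
      push_cast [Nat.cast_sub hb] at h
      exact h
    refine le_trans (le_of_eq ?_) hmin'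
    push_cast
    field_simp
    ring
  · have hle := hdec.mul_le_mul (fun x => (f x).1) ha hm
    push_cast [Nat.cast_sub hb] at hle
    have hden : (0 : ℝ) < (q.choose 2 : ℝ) - ((q : ℝ) - b) := by
      by_contra! hneg
      have hb1 : (1 : ℝ) ≤ b := by exact_mod_cast hb
      have hqb : (b : ℝ) < q := by exact_mod_cast (by omega : b < q)
      have hnonpos : ((b : ℝ) - 1) * ((q : ℝ) - b) / ((q.choose 2 : ℝ) - ((q : ℝ) - b)) ≤ 0 :=
        div_nonpos_of_nonneg_of_nonpos
          (mul_nonneg (by linarith) (by linarith)) hneg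
      have : (0 : ℝ) < d / v := div_pos hd0 hv0
      linarith
    rw [div_lt_div_iff₀ hv0 hden] at hlt
    linarith
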